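/- arXiv:2502.03886 — 3 statements merged into one kernel-verified Lean document; each statement's English description precedes it below -/
import Mathlib

section
/- Under the ACA recursion with nonzero pivots, the k-th residual matrix vanishes on all previously selected pivot rows and columns: for every l with 1 ≤ l ≤ k, R^k_{i_l, j} = 0 for all columns j and R^k_{i, j_l} = 0 for all rows i. -/
/-- Under the ACA recursion with nonzero pivots, the `k`-th residual matrix vanishes on
all previously selected pivot rows and pivot columns. -/
theorem aca_residual_vanishes_on_pivot_crosses
    {n m : ℕ} (k : ℕ) (A : Matrix (Fin n) (Fin m) ℝ)
    (R : ℕ → Matrix (Fin n) (Fin m) ℝ)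
    (ip : ℕ → Fin n) (jp : ℕ → Fin m)
    (hR0 : R 0 = A)
    (hpiv : ∀ l, 1 ≤ l → l ≤ k → R (l - 1) (ip l) (jp l) ≠ 0)
    (hrec : ∀ l, 1 ≤ l → l ≤ k → ∀ i j,
      R l i j = R (l - 1) i j -
        R (l - 1) i (jp l) * R (l - 1) (ip l) j / R (l - 1) (ip l) (jp l)) :
    ∀ l, 1 ≤ l → l ≤ k →
      (∀ j, R k (ip l) j = 0) ∧ (∀ i, R k i (jp l) = 0) := by
  intro l hl hlk
  have vanishes : ∀ p, l ≤ p → p ≤ k →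
      (∀ j, R p (ip l) j = 0) ∧ (∀ i, R p i (jp l) = 0) := by
    intro p hlp
    induction p, hlp using Nat.le_induction with
    | base =>
      intro _
      have hne := hpiv l hl hlk
      refine ⟨fun j => ?_, fun i => ?_⟩
      · rw [hrec l hl hlk, mul_div_cancel_left₀ _ hne, sub_self]
      · rw [hrec l hl hlk, mul_div_cancel_right₀ _ hne, sub_self]
    | succ p hlp ih =>
      intro hpk
      obtain ⟨hrow, hcol⟩ := ih (by omega)
      refine ⟨fun j => ?_, fun i => ?_⟩
      · simp [hrec (p + 1) (by omega) hpk, hrow]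
      · simp [hrec (p + 1) (by omega) hpk, hcol]
  exact vanishes k hlk le_rfl
end

section
/- Under the ACA recursion with nonzero pivots, the rank-k ACA approximation A′_k = A − R^k is a sum of k rank-one matrices (the l-th term being the outer product of the j_l-th column and the i_l-th row of R^{l−1}, divided by the pivot R^{l−1}_{i_l,j_l}); consequently the matrix A − R^k has rank at most k. -/
/-- A finite sum of outer products, one for each index in `s`, has rank at most `s.card`. -/
theorem Matrix.rank_sum_vecMulVec_le {ι p q K : Type*} [Fintype q] [Field K]
    (s : Finset ι) (u : ι → p → K) (v : ι → q → K) :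
    (∑ l ∈ s, Matrix.vecMulVec (u l) (v l)).rank ≤ s.card := by
  have hmul : ∑ l ∈ s, Matrix.vecMulVec (u l) (v l) =
      (Matrix.of fun i (l : s) => u l i) * Matrix.of fun (l : s) j => v l j := by
    ext i j
    rw [← Finset.sum_coe_sort]
    simp [Matrix.mul_apply, Matrix.sum_apply, Matrix.vecMulVec_apply]
  rw [hmul, ← Fintype.card_coe s]
  exact (Matrix.rank_mul_le_left _ _).trans (Matrix.rank_le_card_width _)

/-- The rank-`k` ACA approximation `A - Rᵏ` is the sum of `k` rank-one cross matrices
(the `l`-th term being the outer product of the `j_l`-th column and the `i_l`-th row of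
`R^{l-1}` divided by the pivot value); consequently `A - Rᵏ` has rank at most `k`. -/
theorem aca_approximation_is_sum_of_rank_ones_and_rank_le
    {n m : ℕ} (k : ℕ) (A : Matrix (Fin n) (Fin m) ℝ)
    (R : ℕ → Matrix (Fin n) (Fin m) ℝ)
    (ip : ℕ → Fin n) (jp : ℕ → Fin m)
    (hR0 : R 0 = A)
    (hpiv : ∀ l, 1 ≤ l → l ≤ k → R (l - 1) (ip l) (jp l) ≠ 0)
    (hrec : ∀ l, 1 ≤ l → l ≤ k → ∀ i j,
      R l i j = R (l - 1) i j -
        R (l - 1) i (jp l) * R (l - 1) (ip l) j / R (l - 1) (ip l) (jp l)) :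
    A - R k = (∑ l ∈ Finset.range k, Matrix.of fun i j =>
        R l i (jp (l + 1)) * R l (ip (l + 1)) j / R l (ip (l + 1)) (jp (l + 1))) ∧
    (A - R k).rank ≤ k := by
  have hsum : A - R k = ∑ l ∈ Finset.range k, Matrix.of fun i j =>
      R l i (jp (l + 1)) * R l (ip (l + 1)) j / R l (ip (l + 1)) (jp (l + 1)) := by
    rw [← hR0, ← Finset.sum_range_sub']
    refine Finset.sum_congr rfl fun l hl => ?_
    ext i j
    have h := hrec (l + 1) (Nat.le_add_left 1 l) (Finset.mem_range.mp hl) i j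
    simp only [Nat.add_sub_cancel] at h
    simp [h]
  refine ⟨hsum, ?_⟩
  simpa only [hsum, Matrix.vecMulVec, mul_div_assoc, Finset.card_range] using
    Matrix.rank_sum_vecMulVec_le (Finset.range k) (fun l i => R l i (jp (l + 1)))
      (fun l j => R l (ip (l + 1)) j / R l (ip (l + 1)) (jp (l + 1)))
end

section
/- Let x₁,…,x_n and y₁,…,y_m be points in a real normed vector space with barycenters x̄, ȳ and cloud radii r_X = maxᵢ ‖x_i − x̄‖, r_Y = maxⱼ ‖y_j − ȳ‖, and let η > 0. If 2·max{r_X, r_Y} ≤ (η/(1+η))·‖x̄ − ȳ‖, then the clouds satisfy the admissibility criterion min{2r_X, 2r_Y} ≤ η · dist(X,Y), where dist(X,Y) = min_{i,j} ‖x_i − y_j‖. -/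
/-- If `2·max{r_X, r_Y} ≤ (η/(1+η))·‖x̄ − ȳ‖` then the two clouds satisfy the
admissibility criterion `min{diam(X), diam(Y)} ≤ η · dist(X,Y)`, where the diameters are
`2r_X`, `2r_Y` and `dist(X,Y) = min_{i,j} ‖x_i − y_j‖`. -/
theorem barycenter_condition_implies_admissibility
    {E : Type*} [NormedAddCommGroup E] [NormedSpace ℝ E]
    {n m : ℕ} (hn : 0 < n) (hm : 0 < m)
    (x : Fin n → E) (y : Fin m → E)
    (xbar ybar : E)
    (hxbar : xbar = (n : ℝ)⁻¹ • ∑ i, x i)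
    (hybar : ybar = (m : ℝ)⁻¹ • ∑ j, y j)
    (rX rY : ℝ)
    (hrX : IsGreatest (Set.range fun i => ‖x i - xbar‖) rX)
    (hrY : IsGreatest (Set.range fun j => ‖y j - ybar‖) rY)
    (d : ℝ)
    (hd : IsLeast (Set.range fun p : Fin n × Fin m => ‖x p.1 - y p.2‖) d)
    (η : ℝ) (hη : 0 < η)
    (hadm : 2 * max rX rY ≤ (η / (1 + η)) * ‖xbar - ybar‖) :
    min (2 * rX) (2 * rY) ≤ η * d := by
  obtain ⟨⟨⟨i, j⟩, rfl⟩, -⟩ := hd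
  have hx : ‖x i - xbar‖ ≤ max rX rY := (hrX.2 ⟨i, rfl⟩).trans (le_max_left _ _)
  have hy : ‖y j - ybar‖ ≤ max rX rY := (hrY.2 ⟨j, rfl⟩).trans (le_max_right _ _)
  have htri : ‖xbar - ybar‖ ≤ ‖x i - xbar‖ + ‖x i - y j‖ + ‖y j - ybar‖ := by
    simpa only [dist_eq_norm, norm_sub_rev xbar] using dist_triangle4 xbar (x i) (y j) ybar
  have hbound : ‖xbar - ybar‖ ≤ 2 * max rX rY + ‖x i - y j‖ := by linarith
  have hmin : min (2 * rX) (2 * rY) ≤ 2 * max rX rY :=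
    (min_le_left _ _).trans (by linarith [le_max_left rX rY])
  rw [div_mul_eq_mul_div, le_div_iff₀ (by linarith)] at hadm
  have hscaled := mul_le_mul_of_nonneg_left hbound hη.le
  dsimp only
  linarith
end
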